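/- For a first-order sentence θ over a signature of binary relation symbols, the following are equivalent over finite structures: (1) θ is invariant under disjoint unions, i.e., for every finite family (𝔄_i)_{i∈I} of finite structures, 𝔄_i ⊨ θ for all i∈I if and only if ⊎_{i∈I}𝔄_i ⊨ θ; (2) θ is equivalent over finite structures to a sentence of the form ∀x φ(x), where φ(x) is a two-way restricted first-order formula. -/

import Mathlib

/-- A frame: a first-order structure over a signature consisting of
binary relation symbols indexed by `I`. -/
structure KFrame (I : Type) where
  W : Type
  R : I → W → W → Prop

/-- First-order formulas over a signature of binary relation symbols indexed
by `I`, with variables indexed by `ℕ`. -/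
inductive FO (I : Type) : Type
  | eq : ℕ → ℕ → FO I
  | rel : I → ℕ → ℕ → FO I
  | fal : FO I
  | neg : FO I → FO I
  | and : FO I → FO I → FO I
  | or : FO I → FO I → FO I
  | imp : FO I → FO I → FO I
  | ex : ℕ → FO I → FO I
  | all : ℕ → FO I → FO I

/-- Tarskian satisfaction of a first-order formula in a frame, relative to a
variable assignment `g`. -/
def FOSat {I : Type} (F : KFrame I) : (ℕ → F.W) → FO I → Prop
  | g, .eq x y => g x = g y
  | g, .rel i x y => F.R i (g x) (g y)
  | _, .fal => False
  | g, .neg φ => ¬ FOSat F g φ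
  | g, .and φ ψ => FOSat F g φ ∧ FOSat F g ψ
  | g, .or φ ψ => FOSat F g φ ∨ FOSat F g ψ
  | g, .imp φ ψ => FOSat F g φ → FOSat F g ψ
  | g, .ex x φ => ∃ d : F.W, FOSat F (Function.update g x d) φ
  | g, .all x φ => ∀ d : F.W, FOSat F (Function.update g x d) φ

/-- The free variables of a first-order formula. -/
def freeVars {I : Type} : FO I → Finset ℕ
  | .eq x y => {x, y}
  | .rel _ x y => {x, y}
  | .fal => ∅
  | .neg φ => freeVars φ
  | .and φ ψ => freeVars φ ∪ freeVars ψ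
  | .or φ ψ => freeVars φ ∪ freeVars ψ
  | .imp φ ψ => freeVars φ ∪ freeVars ψ
  | .ex x φ => freeVars φ \ {x}
  | .all x φ => freeVars φ \ {x}

/-- Truth of a (closed) first-order formula in a frame. -/
def FrameSat {I : Type} (F : KFrame I) (φ : FO I) : Prop :=
  ∀ g : ℕ → F.W, FOSat F g φ

/-- The disjoint union of a family of frames. -/
def disjUnion {I ι : Type} (F : ι → KFrame I) : KFrame I where
  W := Σ i : ι, (F i).W
  R := fun r x y =>
    ∃ (i : ι) (u v : (F i).W), x = ⟨i, u⟩ ∧ y = ⟨i, v⟩ ∧ (F i).R r u v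

/-- Two-way restricted first-order formulas: the only quantifiers allowed are
the restricted universal quantifiers `∀y(R(z,y) → …)`, `∀y(R(y,z) → …)` and the
restricted existential quantifiers `∃y(R(z,y) ∧ …)`, `∃y(R(y,z) ∧ …)`, where
`z` is a variable distinct from `y`. -/
inductive TwoWayRestricted {I : Type} : FO I → Prop
  | eq (x y : ℕ) : TwoWayRestricted (.eq x y)
  | rel (i : I) (x y : ℕ) : TwoWayRestricted (.rel i x y)
  | fal : TwoWayRestricted .fal
  | neg {φ : FO I} : TwoWayRestricted φ → TwoWayRestricted (.neg φ)
  | and {φ ψ : FO I} :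
      TwoWayRestricted φ → TwoWayRestricted ψ → TwoWayRestricted (.and φ ψ)
  | or {φ ψ : FO I} :
      TwoWayRestricted φ → TwoWayRestricted ψ → TwoWayRestricted (.or φ ψ)
  | imp {φ ψ : FO I} :
      TwoWayRestricted φ → TwoWayRestricted ψ → TwoWayRestricted (.imp φ ψ)
  | allL (i : I) (z y : ℕ) {φ : FO I} :
      y ≠ z → TwoWayRestricted φ → TwoWayRestricted (.all y (.imp (.rel i z y) φ))
  | allR (i : I) (z y : ℕ) {φ : FO I} :
      y ≠ z → TwoWayRestricted φ → TwoWayRestricted (.all y (.imp (.rel i y z) φ))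
  | exL (i : I) (z y : ℕ) {φ : FO I} :
      y ≠ z → TwoWayRestricted φ → TwoWayRestricted (.ex y (.and (.rel i z y) φ))
  | exR (i : I) (z y : ℕ) {φ : FO I} :
      y ≠ z → TwoWayRestricted φ → TwoWayRestricted (.ex y (.and (.rel i y z) φ))

open Function

section Semantics

variable {I : Type}

/-- Satisfaction depends only on the values of the free variables. -/
theorem FOSat_congr {F : KFrame I} (φ : FO I) :
    ∀ {g h : ℕ → F.W}, (∀ v ∈ freeVars φ, g v = h v) → (FOSat F g φ ↔ FOSat F h φ) := by
  have key : ∀ (x : ℕ) (ψ : FO I) (g h : ℕ → F.W) (d : F.W),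
      (∀ v ∈ freeVars ψ \ {x}, g v = h v) →
      ∀ v ∈ freeVars ψ, update g x d v = update h x d v := by
    intro x ψ g h d H v hv
    by_cases hvx : v = x
    · subst hvx; simp
    · simpa [hvx] using H v (by simp [hv, hvx])
  induction φ with
  | eq x y =>
    intro g h H
    simp [FOSat, H x (by simp [freeVars]), H y (by simp [freeVars])]
  | rel i x y =>
    intro g h H
    simp [FOSat, H x (by simp [freeVars]), H y (by simp [freeVars])]
  | fal => intro g h _; rfl
  | neg φ ih => intro g h H; exact not_congr (ih H)
  | and φ ψ ih₁ ih₂ =>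
    intro g h H
    exact and_congr (ih₁ fun v hv => H v (Finset.mem_union_left _ hv))
      (ih₂ fun v hv => H v (Finset.mem_union_right _ hv))
  | or φ ψ ih₁ ih₂ =>
    intro g h H
    exact or_congr (ih₁ fun v hv => H v (Finset.mem_union_left _ hv))
      (ih₂ fun v hv => H v (Finset.mem_union_right _ hv))
  | imp φ ψ ih₁ ih₂ =>
    intro g h H
    exact imp_congr (ih₁ fun v hv => H v (Finset.mem_union_left _ hv))
      (ih₂ fun v hv => H v (Finset.mem_union_right _ hv))
  | ex x φ ih =>
    intro g h H
    exact exists_congr fun d => ih (key x φ g h d H)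
  | all x φ ih =>
    intro g h H
    exact forall_congr' fun d => ih (key x φ g h d H)

theorem frameSat_all {F : KFrame I} (x : ℕ) (φ : FO I) :
    FrameSat F (.all x φ) ↔ FrameSat F φ :=
  ⟨fun H g => by simpa [FOSat] using H g (g x), fun H g d => H (update g x d)⟩

end Semantics

section DisjointUnion

variable {I ι : Type} (F : ι → KFrame I)

/-- The inclusion of a component into the disjoint union. -/
def componentIncl (i : ι) (w : (F i).W) : (disjUnion F).W := ⟨i, w⟩

theorem componentIncl_inj {i : ι} {u v : (F i).W} :
    componentIncl F i u = componentIncl F i v ↔ u = v :=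
  sigma_mk_injective.eq_iff

theorem disjUnion_R_componentIncl (r : I) {i : ι} {u v : (F i).W} :
    (disjUnion F).R r (componentIncl F i u) (componentIncl F i v) ↔ (F i).R r u v := by
  constructor
  · rintro ⟨j, u', v', h₁, h₂, h⟩
    cases h₁; cases h₂; exact h
  · exact fun h => ⟨i, u, v, rfl, rfl, h⟩

theorem fst_eq_of_disjUnion_R {r : I} {x y : (disjUnion F).W} (h : (disjUnion F).R r x y) :
    x.1 = y.1 := by
  obtain ⟨i, u, v, rfl, rfl, -⟩ := h
  rfl

theorem update_componentIncl {i : ι} (g : ℕ → (F i).W) (y : ℕ) (d : (F i).W) :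
    update (fun v => componentIncl F i (g v)) y (componentIncl F i d) =
      fun v => componentIncl F i (update g y d v) := by
  funext v
  by_cases h : v = y
  · subst h; simp
  · simp [h]

/-- Two-way restricted formulas are absolute between a component and the disjoint union. -/
theorem TwoWayRestricted.disjUnion_iff {φ : FO I} (hφ : TwoWayRestricted φ) {i : ι} :
    ∀ g : ℕ → (F i).W,
      FOSat (disjUnion F) (fun v => componentIncl F i (g v)) φ ↔ FOSat (F i) g φ := by
  have fst_eq : ∀ (g : ℕ → (F i).W) {y z : ℕ} (x : (disjUnion F).W) (r : I) (b : Bool), y ≠ z →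
      (disjUnion F).R r
        (update (fun v => componentIncl F i (g v)) y x (if b then z else y))
        (update (fun v => componentIncl F i (g v)) y x (if b then y else z)) → x.1 = i := by
    intro g y z x r b hyz h
    have h := fst_eq_of_disjUnion_R F h
    cases b
    · rw [if_neg Bool.false_ne_true, if_neg Bool.false_ne_true, update_self,
        update_of_ne hyz.symm] at h
      exact h
    · rw [if_pos rfl, if_pos rfl, update_self, update_of_ne hyz.symm] at h
      exact h.symm
  have ex_iff : ∀ (P : (disjUnion F).W → Prop) (Q : (F i).W → Prop),
      (∀ x, P x → x.1 = i) → (∀ d, P (componentIncl F i d) ↔ Q d) → ((∃ x, P x) ↔ ∃ d, Q d) := by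
    intro P Q hi H
    constructor
    · rintro ⟨⟨j, d⟩, hx⟩
      obtain rfl : j = i := hi _ hx
      exact ⟨d, (H d).1 hx⟩
    · rintro ⟨d, hd⟩
      exact ⟨⟨i, d⟩, (H d).2 hd⟩
  have all_iff : ∀ (P P' : (disjUnion F).W → Prop) (Q Q' : (F i).W → Prop),
      (∀ x, P x → x.1 = i) → (∀ d, P (componentIncl F i d) ↔ Q d) → (∀ d, P' (componentIncl F i d) ↔ Q' d) →
      ((∀ x, P x → P' x) ↔ ∀ d, Q d → Q' d) := by
    intro P P' Q Q' hi H H'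
    constructor
    · intro h d hd
      exact (H' d).1 (h _ ((H d).2 hd))
    · rintro h ⟨j, d⟩ hx
      obtain rfl : j = i := hi _ hx
      exact (H' d).2 (h d ((H d).1 hx))
  induction hφ with
  | eq x y => intro g; exact componentIncl_inj F
  | rel r x y => intro g; exact disjUnion_R_componentIncl F r
  | fal => intro g; rfl
  | neg _ ih => intro g; exact not_congr (ih g)
  | and _ _ ih₁ ih₂ => intro g; exact and_congr (ih₁ g) (ih₂ g)
  | or _ _ ih₁ ih₂ => intro g; exact or_congr (ih₁ g) (ih₂ g)
  | imp _ _ ih₁ ih₂ => intro g; exact imp_congr (ih₁ g) (ih₂ g)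
  | allL r z y hyz _ ih =>
    intro g
    refine all_iff _ _ _ _ (fun x hx => ?_) (fun d => ?_) fun d => ?_
    · exact fst_eq g x r true hyz hx
    · rw [update_componentIncl]; exact disjUnion_R_componentIncl F r
    · rw [update_componentIncl]; exact ih _
  | allR r z y hyz _ ih =>
    intro g
    refine all_iff _ _ _ _ (fun x hx => ?_) (fun d => ?_) fun d => ?_
    · exact fst_eq g x r false hyz hx
    · rw [update_componentIncl]; exact disjUnion_R_componentIncl F r
    · rw [update_componentIncl]; exact ih _
  | exL r z y hyz _ ih =>
    intro g
    refine ex_iff _ _ (fun x hx => ?_) fun d => ?_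
    · exact fst_eq g x r true hyz hx.1
    · rw [update_componentIncl]; exact and_congr (disjUnion_R_componentIncl F r) (ih _)
  | exR r z y hyz _ ih =>
    intro g
    refine ex_iff _ _ (fun x hx => ?_) fun d => ?_
    · exact fst_eq g x r false hyz hx.1
    · rw [update_componentIncl]; exact and_congr (disjUnion_R_componentIncl F r) (ih _)

theorem frameSat_disjUnion_iff {x : ℕ} {φ : FO I} (hφ : TwoWayRestricted φ)
    (hx : freeVars (FO.all x φ) = ∅) :
    (∀ i, FrameSat (F i) (.all x φ)) ↔ FrameSat (disjUnion F) (.all x φ) := by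
  simp only [frameSat_all]
  constructor
  · intro H g
    refine (FOSat_congr φ (h := fun _ => componentIncl F (g x).1 (g x).2) fun v hv => ?_).2
      ((hφ.disjUnion_iff F _).2 (H _ _))
    obtain rfl : v = x := by
      simpa using (Finset.sdiff_eq_empty_iff_subset.1 hx) hv
    rfl
  · intro H i g
    exact (hφ.disjUnion_iff F g).1 (H _)

end DisjointUnion

section Definability

variable {I : Type}

/-- The edge relation for the symbol `r`, traversed forwards or backwards. -/
def KFrame.Step (F : KFrame I) (r : I) : Bool → F.W → F.W → Prop
  | true, x, y => F.R r x y
  | false, x, y => F.R r y x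

theorem KFrame.Step.symm {F : KFrame I} {r : I} {b : Bool} {x y : F.W} (h : F.Step r b x y) :
    F.Step r (!b) y x := by
  cases b <;> exact h

/-- A property of assignments defined by a two-way restricted formula in the variables
below `n`, uniformly in all frames. -/
def RestrictedDefinable (n : ℕ) (P : ∀ F : KFrame I, (ℕ → F.W) → Prop) : Prop :=
  ∃ φ : FO I, TwoWayRestricted φ ∧ freeVars φ ⊆ Finset.range n ∧
    ∀ F g, FOSat F g φ ↔ P F g

namespace RestrictedDefinable

variable {n : ℕ} {P Q : ∀ F : KFrame I, (ℕ → F.W) → Prop}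

theorem not (hP : RestrictedDefinable n P) : RestrictedDefinable n fun F g => ¬ P F g := by
  obtain ⟨φ, h₁, h₂, h₃⟩ := hP
  exact ⟨.neg φ, h₁.neg, h₂, fun F g => not_congr (h₃ F g)⟩

theorem and (hP : RestrictedDefinable n P) (hQ : RestrictedDefinable n Q) :
    RestrictedDefinable n fun F g => P F g ∧ Q F g := by
  obtain ⟨φ, h₁, h₂, h₃⟩ := hP
  obtain ⟨ψ, k₁, k₂, k₃⟩ := hQ
  exact ⟨.and φ ψ, h₁.and k₁, Finset.union_subset h₂ k₂,
    fun F g => and_congr (h₃ F g) (k₃ F g)⟩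

theorem false : RestrictedDefinable (I := I) n fun _ _ => False :=
  ⟨.fal, .fal, by simp [freeVars], fun _ _ => Iff.rfl⟩

theorem const (p : Prop) : RestrictedDefinable (I := I) n fun _ _ => p := by
  by_cases hp : p
  · simpa [hp] using (false (I := I) (n := n)).not
  · simpa [hp] using false (I := I) (n := n)

theorem iff_const (hP : RestrictedDefinable n P) (p : Prop) :
    RestrictedDefinable n fun F g => P F g ↔ p := by
  by_cases hp : p
  · simpa [hp] using hP
  · simpa [hp] using hP.not

theorem forall_finite {J : Type} [Finite J] {P : J → ∀ F : KFrame I, (ℕ → F.W) → Prop}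
    (hP : ∀ j, RestrictedDefinable n (P j)) :
    RestrictedDefinable n fun F g => ∀ j, P j F g := by
  classical
  have := Fintype.ofFinite J
  suffices ∀ s : Finset J, RestrictedDefinable n fun F g => ∀ j ∈ s, P j F g by
    simpa using this Finset.univ
  intro s
  induction s using Finset.induction_on with
  | empty => simpa using const (I := I) (n := n) True
  | insert a s _ ih => simpa using (hP a).and ih

theorem exists_finite {J : Type} [Finite J] {P : J → ∀ F : KFrame I, (ℕ → F.W) → Prop}
    (hP : ∀ j, RestrictedDefinable n (P j)) :
    RestrictedDefinable n fun F g => ∃ j, P j F g := by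
  simpa using (forall_finite fun j => (hP j).not).not

/-- Membership of the set of satisfied predicates in a prescribed collection is definable. -/
theorem setOf_mem {J : Type} [Finite J] {P : J → ∀ F : KFrame I, (ℕ → F.W) → Prop}
    (hP : ∀ j, RestrictedDefinable n (P j)) (T : Set (Set J)) :
    RestrictedDefinable n fun F g => {j | P j F g} ∈ T := by
  have : RestrictedDefinable n fun F g => ∃ X : T, ∀ j, P j F g ↔ j ∈ (X : Set J) :=
    exists_finite fun X => forall_finite fun j => (hP j).iff_const _
  convert this using 3 with F g
  constructor
  · exact fun h => ⟨⟨_, h⟩, fun j => Iff.rfl⟩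
  · rintro ⟨⟨X, hX⟩, h⟩
    rwa [show {j | P j F g} = X from Set.ext h]

theorem exists_step (hP : RestrictedDefinable (n + 1) P) (r : I) (b : Bool) {k : ℕ}
    (hk : k < n) :
    RestrictedDefinable n fun F g => ∃ y, F.Step r b (g k) y ∧ P F (update g n y) := by
  obtain ⟨φ, h₁, h₂, h₃⟩ := hP
  have hvars : ∀ v, v = k ∨ v = n ∨ v ∈ freeVars φ → v ≠ n → v < n := by
    rintro v (rfl | rfl | hv) hvn
    · exact hk
    · exact absurd rfl hvn
    · have := Finset.mem_range.1 (h₂ hv)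
      omega
  cases b
  · refine ⟨.ex n (.and (.rel r n k) φ), .exR r k n hk.ne' h₁, fun v hv => ?_, fun F g => ?_⟩
    · simp only [freeVars, Finset.mem_sdiff, Finset.mem_union, Finset.mem_insert,
        Finset.mem_singleton] at hv
      exact Finset.mem_range.2 (hvars v (by tauto) hv.2)
    · simp [FOSat, KFrame.Step, hk.ne, h₃]
  · refine ⟨.ex n (.and (.rel r k n) φ), .exL r k n hk.ne' h₁, fun v hv => ?_, fun F g => ?_⟩
    · simp only [freeVars, Finset.mem_sdiff, Finset.mem_union, Finset.mem_insert,
        Finset.mem_singleton] at hv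
      exact Finset.mem_range.2 (hvars v (by tauto) hv.2)
    · simp [FOSat, KFrame.Step, hk.ne, h₃]

/-- Restricted definable properties are absolute between a component and the disjoint union. -/
theorem disjUnion_iff (hP : RestrictedDefinable n P) {ι : Type} (F : ι → KFrame I) {i : ι}
    (g : ℕ → (F i).W) : P (disjUnion F) (fun v => componentIncl F i (g v)) ↔ P (F i) g := by
  obtain ⟨φ, h₁, -, h₃⟩ := hP
  rw [← h₃, ← h₃, h₁.disjUnion_iff F g]

end RestrictedDefinable

end Definability

section LocalEquivalence

variable {I : Type}

/-- Local back-and-forth equivalence of depth `d`: the pebbles in `p` form a partial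
isomorphism for the symbols in `S`, and for `d` rounds a new pebble may be placed on an
element adjacent to a pebbled one. -/
def LocEq (S : Finset I) (F G : KFrame I) : ℕ → Set (F.W × G.W) → Prop
  | 0, p => ∀ x ∈ p, ∀ y ∈ p, (x.1 = y.1 ↔ x.2 = y.2) ∧
      ∀ r ∈ S, (F.R r x.1 y.1 ↔ G.R r x.2 y.2)
  | d + 1, p => LocEq S F G d p ∧ ∀ x ∈ p, ∀ r ∈ S, ∀ b,
      (∀ u, F.Step r b x.1 u → ∃ v, G.Step r b x.2 v ∧ LocEq S F G d (insert (u, v) p)) ∧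
      (∀ v, G.Step r b x.2 v → ∃ u, F.Step r b x.1 u ∧ LocEq S F G d (insert (u, v) p))

variable {S : Finset I} {F G : KFrame I}

theorem LocEq.subset {d : ℕ} : ∀ {p q : Set (F.W × G.W)}, LocEq S F G d q → p ⊆ q →
    LocEq S F G d p := by
  induction d with
  | zero => exact fun h hpq x hx y hy => h x (hpq hx) y (hpq hy)
  | succ d ih =>
    refine fun h hpq => ⟨ih h.1 hpq, fun x hx r hr b => ⟨fun u hu => ?_, fun v hv => ?_⟩⟩
    · obtain ⟨v, hv, h'⟩ := (h.2 x (hpq hx) r hr b).1 u hu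
      exact ⟨v, hv, ih h' (Set.insert_subset_insert hpq)⟩
    · obtain ⟨u, hu, h'⟩ := (h.2 x (hpq hx) r hr b).2 v hv
      exact ⟨u, hu, ih h' (Set.insert_subset_insert hpq)⟩

theorem LocEq.of_le {d e : ℕ} {p : Set (F.W × G.W)} (h : LocEq S F G e p) (hde : d ≤ e) :
    LocEq S F G d p := by
  induction hde with
  | refl => exact h
  | step _ ih => exact ih h.1

theorem locEq_empty (d : ℕ) : LocEq S F G d ∅ := by
  induction d with
  | zero => exact fun x hx => hx.elim
  | succ d ih => exact ⟨ih, fun x hx => hx.elim⟩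

/-- Finitely many restricted definable predicates suffice to guarantee local equivalence. -/
theorem exists_definable_locEq (S : Finset I) (d : ℕ) : ∀ n : ℕ,
    ∃ (J : Type) (_ : Finite J) (P : J → ∀ F : KFrame I, (ℕ → F.W) → Prop),
      (∀ j, RestrictedDefinable n (P j)) ∧
      ∀ (F G : KFrame I) (g : ℕ → F.W) (h : ℕ → G.W), (∀ j, P j F g ↔ P j G h) →
        LocEq S F G d ((fun i => (g i, h i)) '' Set.Iio n) := by
  induction d with
  | zero =>
    intro n
    refine ⟨(Fin n × Fin n) ⊕ (S × Fin n × Fin n), inferInstance,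
      Sum.elim (fun j F g => g j.1 = g j.2) (fun j F g => F.R j.1 (g j.2.1) (g j.2.2)), ?_, ?_⟩
    · have hsub : ∀ i j : Fin n, ({(i : ℕ), (j : ℕ)} : Finset ℕ) ⊆ Finset.range n := by
        intro i j v hv
        rcases Finset.mem_insert.1 hv with rfl | hv
        · simp
        · simp [Finset.mem_singleton.1 hv]
      rintro (⟨i, j⟩ | ⟨r, i, j⟩)
      · exact ⟨.eq i j, .eq _ _, hsub i j, fun _ _ => Iff.rfl⟩
      · exact ⟨.rel r i j, .rel _ _ _, hsub i j, fun _ _ => Iff.rfl⟩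
    · rintro F G g h H _ ⟨i, hi, rfl⟩ _ ⟨j, hj, rfl⟩
      exact ⟨H (.inl (⟨i, hi⟩, ⟨j, hj⟩)), fun r hr => H (.inr (⟨r, hr⟩, ⟨i, hi⟩, ⟨j, hj⟩))⟩
  | succ d ih =>
    intro n
    obtain ⟨J₁, _, P₁, hP₁, H₁⟩ := ih n
    obtain ⟨J₂, _, P₂, hP₂, H₂⟩ := ih (n + 1)
    refine ⟨J₁ ⊕ (S × Bool × Fin n × Set J₂), inferInstance,
      Sum.elim P₁ (fun j F g => ∃ y, F.Step j.1 j.2.1 (g j.2.2.1) y ∧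
        {k | P₂ k F (update g n y)} ∈ ({j.2.2.2} : Set (Set J₂))), ?_, ?_⟩
    · rintro (j | ⟨r, b, i, X⟩)
      · exact hP₁ j
      · exact (RestrictedDefinable.setOf_mem hP₂ {X}).exists_step r b i.2
    · intro F G g h H
      have hins : ∀ u v, insert (u, v) ((fun i => (g i, h i)) '' Set.Iio n) ⊆
          (fun i => (update g n u i, update h n v i)) '' Set.Iio (n + 1) := by
        rintro u v _ (rfl | ⟨i, hi, rfl⟩)
        · exact ⟨n, by simp, by simp⟩
        · have hi' : i < n := hi
          exact ⟨i, Nat.lt_succ_of_lt hi', by simp [hi'.ne]⟩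
      refine ⟨H₁ F G g h fun j => H (.inl j), ?_⟩
      rintro _ ⟨i, hi, rfl⟩ r hr b
      refine ⟨fun u hu => ?_, fun v hv => ?_⟩
      · obtain ⟨v, hv, hX⟩ := (H (.inr (⟨r, hr⟩, b, ⟨i, hi⟩, {k | P₂ k F (update g n u)}))).1
          ⟨u, hu, rfl⟩
        exact ⟨v, hv, (H₂ F G _ _ fun k => (Set.ext_iff.1 hX k).symm).subset (hins u v)⟩
      · obtain ⟨u, hu, hX⟩ := (H (.inr (⟨r, hr⟩, b, ⟨i, hi⟩, {k | P₂ k G (update h n v)}))).2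
          ⟨v, hv, rfl⟩
        exact ⟨u, hu, (H₂ F G _ _ fun k => Set.ext_iff.1 hX k).subset (hins u v)⟩

end LocalEquivalence

section Distance

variable {I : Type}

/-- `Near S F k x y`: the distance from `x` to `y` in the Gaifman graph of the symbols in `S`
is at most `k`. -/
def Near (S : Finset I) (F : KFrame I) : ℕ → F.W → F.W → Prop
  | 0, x, y => x = y
  | k + 1, x, y => Near S F k x y ∨ ∃ r ∈ S, ∃ b z, F.Step r b x z ∧ Near S F k z y

variable {S : Finset I} {F G : KFrame I}

theorem Near.refl (k : ℕ) (x : F.W) : Near S F k x x := by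
  induction k with
  | zero => rfl
  | succ k ih => exact .inl ih

theorem Near.of_le {k l : ℕ} {x y : F.W} (h : Near S F k x y) (hkl : k ≤ l) :
    Near S F l x y := by
  induction hkl with
  | refl => exact h
  | step _ ih => exact .inl ih

theorem Near.tail {r : I} (hr : r ∈ S) {b : Bool} {k : ℕ} {y z : F.W} (hs : F.Step r b y z) :
    ∀ {x : F.W}, Near S F k x y → Near S F (k + 1) x z := by
  induction k with
  | zero => rintro _ rfl; exact .inr ⟨r, hr, b, z, hs, rfl⟩
  | succ k ih =>
    rintro x (h | ⟨r', hr', b', w, hw, h⟩)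
    · exact .inl (ih h)
    · exact .inr ⟨r', hr', b', w, hw, ih h⟩

theorem Near.symm {k : ℕ} : ∀ {x y : F.W}, Near S F k x y → Near S F k y x := by
  induction k with
  | zero => exact fun h => Eq.symm h
  | succ k ih =>
    rintro x y (h | ⟨r, hr, b, z, hs, h⟩)
    · exact .inl (ih h)
    · exact (ih h).tail hr hs.symm

theorem Near.fst_eq {ι : Type} {A : ι → KFrame I} {k : ℕ} :
    ∀ {x y : (disjUnion A).W}, Near S (disjUnion A) k x y → x.1 = y.1 := by
  induction k with
  | zero => rintro x _ rfl; rfl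
  | succ k ih =>
    rintro x y (h | ⟨r, hr, b, z, hs, h⟩)
    · exact ih h
    · refine Eq.trans ?_ (ih h)
      cases b
      · exact (fst_eq_of_disjUnion_R A hs).symm
      · exact fst_eq_of_disjUnion_R A hs

/-- A move to an element of bounded distance from the pebbles can be answered. -/
theorem LocEq.exists_right_of_near {d k : ℕ} {u : F.W} : ∀ {p : Set (F.W × G.W)} {x},
    LocEq S F G (k + d) p → x ∈ p → Near S F k x.1 u →
      ∃ v, LocEq S F G d (insert (u, v) p) := by
  induction k with
  | zero =>
    rintro p x h hx rfl
    exact ⟨x.2, by rwa [Set.insert_eq_of_mem hx, ← Nat.zero_add d]⟩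
  | succ k ih =>
    rintro p x h hx (hn | ⟨r, hr, b, z, hs, hn⟩)
    · exact ih (h.of_le (by omega)) hx hn
    · rw [Nat.succ_add] at h
      obtain ⟨w, -, h'⟩ := (h.2 x hx r hr b).1 z hs
      obtain ⟨v, hv⟩ := ih h' (Set.mem_insert _ _) hn
      exact ⟨v, hv.subset (Set.insert_subset_insert (Set.subset_insert _ _))⟩

theorem LocEq.exists_left_of_near {d k : ℕ} {v : G.W} : ∀ {p : Set (F.W × G.W)} {x},
    LocEq S F G (k + d) p → x ∈ p → Near S G k x.2 v →
      ∃ u, LocEq S F G d (insert (u, v) p) := by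
  induction k with
  | zero =>
    rintro p x h hx rfl
    exact ⟨x.1, by rwa [Set.insert_eq_of_mem hx, ← Nat.zero_add d]⟩
  | succ k ih =>
    rintro p x h hx (hn | ⟨r, hr, b, z, hs, hn⟩)
    · exact ih (h.of_le (by omega)) hx hn
    · rw [Nat.succ_add] at h
      obtain ⟨w, -, h'⟩ := (h.2 x hx r hr b).2 z hs
      obtain ⟨u, hu⟩ := ih h' (Set.mem_insert _ _) hn
      exact ⟨u, hu.subset (Set.insert_subset_insert (Set.subset_insert _ _))⟩

/-- Two sets of pebble pairs at distance more than `k` from each other on both sides. -/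
def Far (S : Finset I) (F G : KFrame I) (k : ℕ) (p q : Set (F.W × G.W)) : Prop :=
  ∀ x ∈ p, ∀ y ∈ q, ¬ Near S F k x.1 y.1 ∧ ¬ Near S G k x.2 y.2

theorem Far.symm {k : ℕ} {p q : Set (F.W × G.W)} (h : Far S F G k p q) : Far S F G k q p :=
  fun x hx y hy => ⟨fun hn => (h y hy x hx).1 hn.symm, fun hn => (h y hy x hx).2 hn.symm⟩

theorem Far.of_le {k l : ℕ} {p q : Set (F.W × G.W)} (h : Far S F G l p q) (hkl : k ≤ l) :
    Far S F G k p q :=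
  fun x hx y hy => ⟨fun hn => (h x hx y hy).1 (hn.of_le hkl),
    fun hn => (h x hx y hy).2 (hn.of_le hkl)⟩

theorem Far.insert {k : ℕ} {p q : Set (F.W × G.W)} (h : Far S F G (k + 1) p q)
    {x : F.W × G.W} (hx : x ∈ p) {r : I} (hr : r ∈ S) {b : Bool} {u : F.W} {v : G.W}
    (hu : F.Step r b x.1 u) (hv : G.Step r b x.2 v) : Far S F G k (insert (u, v) p) q := by
  rintro y (rfl | hy) z hz
  · exact ⟨fun hn => (h x hx z hz).1 (.inr ⟨r, hr, b, u, hu, hn⟩),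
      fun hn => (h x hx z hz).2 (.inr ⟨r, hr, b, v, hv, hn⟩)⟩
  · exact (h.of_le k.le_succ) y hy z hz

/-- Local equivalences of sets of pebbles that are far apart can be combined. -/
theorem LocEq.union {d : ℕ} : ∀ {p q : Set (F.W × G.W)}, LocEq S F G d p → LocEq S F G d q →
    Far S F G (2 * d + 1) p q → LocEq S F G d (p ∪ q) := by
  induction d with
  | zero =>
    intro p q hp hq hf
    have cross : ∀ {p q : Set (F.W × G.W)}, Far S F G 1 p q → ∀ x ∈ p, ∀ y ∈ q,
        (x.1 = y.1 ↔ x.2 = y.2) ∧ ∀ r ∈ S, (F.R r x.1 y.1 ↔ G.R r x.2 y.2) := by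
      intro p q hf x hx y hy
      obtain ⟨h₁, h₂⟩ := hf x hx y hy
      refine ⟨iff_of_false (fun h => h₁ (h ▸ .refl _ _)) (fun h => h₂ (h ▸ .refl _ _)),
        fun r hr => iff_of_false (fun h => h₁ ?_) (fun h => h₂ ?_)⟩
      · exact .inr ⟨r, hr, true, _, h, rfl⟩
      · exact .inr ⟨r, hr, true, _, h, rfl⟩
    rintro x (hx | hx) y (hy | hy)
    · exact hp x hx y hy
    · exact cross hf x hx y hy
    · exact cross hf.symm x hx y hy
    · exact hq x hx y hy
  | succ d ih =>
    have moves : ∀ {p q : Set (F.W × G.W)}, LocEq S F G (d + 1) p → LocEq S F G (d + 1) q →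
        Far S F G (2 * (d + 1) + 1) p q → ∀ x ∈ p, ∀ r ∈ S, ∀ b,
        (∀ u, F.Step r b x.1 u →
          ∃ v, G.Step r b x.2 v ∧ LocEq S F G d (insert (u, v) (p ∪ q))) ∧
        (∀ v, G.Step r b x.2 v →
          ∃ u, F.Step r b x.1 u ∧ LocEq S F G d (insert (u, v) (p ∪ q))) := by
      intro p q hp hq hf x hx r hr b
      have hf' : Far S F G (2 * d + 1 + 1) p q := hf.of_le (by omega)
      refine ⟨fun u hu => ?_, fun v hv => ?_⟩
      · obtain ⟨v, hv, h⟩ := (hp.2 x hx r hr b).1 u hu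
        exact ⟨v, hv, Set.insert_union ▸ ih h hq.1 (hf'.insert hx hr hu hv)⟩
      · obtain ⟨u, hu, h⟩ := (hp.2 x hx r hr b).2 v hv
        exact ⟨u, hu, Set.insert_union ▸ ih h hq.1 (hf'.insert hx hr hu hv)⟩
    intro p q hp hq hf
    refine ⟨ih hp.1 hq.1 (hf.of_le (by omega)), ?_⟩
    rintro x (hx | hx)
    · exact moves hp hq hf x hx
    · rw [Set.union_comm]
      exact moves hq hp hf.symm x hx

end Distance

section Game

variable {I : Type}

/-- The relation symbols occurring in a formula. -/
noncomputable def relSymbols : FO I → Finset I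
  | .eq _ _ => ∅
  | .rel i _ _ => {i}
  | .fal => ∅
  | .neg φ => relSymbols φ
  | .and φ ψ => open Classical in relSymbols φ ∪ relSymbols ψ
  | .or φ ψ => open Classical in relSymbols φ ∪ relSymbols ψ
  | .imp φ ψ => open Classical in relSymbols φ ∪ relSymbols ψ
  | .ex _ φ => relSymbols φ
  | .all _ φ => relSymbols φ

/-- The quantifier rank of a formula. -/
def quantRank : FO I → ℕ
  | .eq _ _ => 0
  | .rel _ _ _ => 0
  | .fal => 0
  | .neg φ => quantRank φ
  | .and φ ψ => max (quantRank φ) (quantRank ψ)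
  | .or φ ψ => max (quantRank φ) (quantRank ψ)
  | .imp φ ψ => max (quantRank φ) (quantRank ψ)
  | .ex _ φ => quantRank φ + 1
  | .all _ φ => quantRank φ + 1

/-- The depth of local equivalence needed to play `k` unrestricted rounds. -/
def gameDepth : ℕ → ℕ
  | 0 => 0
  | k + 1 => 2 * gameDepth k + 1 + gameDepth k

theorem gameDepth_mono : Monotone gameDepth :=
  monotone_nat_of_le_succ fun k => by simp only [gameDepth]; omega

/-- Every element of `F` has a locally equivalent partner in `G` out of reach of any fewer
than `N` given elements, and conversely. -/
def Rich (S : Finset I) (F G : KFrame I) (d N : ℕ) : Prop :=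
  (∀ (u : F.W) (p : Set (F.W × G.W)), p.Finite → p.ncard < N →
    ∃ v : G.W, LocEq S F G d {(u, v)} ∧ ∀ x ∈ p, ∀ k, ¬ Near S G k x.2 v) ∧
  (∀ (v : G.W) (p : Set (F.W × G.W)), p.Finite → p.ncard < N →
    ∃ u : F.W, LocEq S F G d {(u, v)} ∧ ∀ x ∈ p, ∀ k, ¬ Near S F k x.1 u)

variable {S : Finset I} {F G : KFrame I} {D N : ℕ}

theorem Rich.exists_right (hR : Rich S F G D N) {k : ℕ} (hk : gameDepth k ≤ D)
    {p : Set (F.W × G.W)} (hp : LocEq S F G (gameDepth (k + 1)) p) (hfin : p.Finite)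
    (hN : p.ncard < N) (u : F.W) : ∃ v, LocEq S F G (gameDepth k) (insert (u, v) p) := by
  by_cases hnear : ∃ x ∈ p, Near S F (2 * gameDepth k + 1) x.1 u
  · obtain ⟨x, hx, hn⟩ := hnear
    exact hp.exists_right_of_near hx hn
  · obtain ⟨v, hv, hfar⟩ := hR.1 u p hfin hN
    refine ⟨v, ?_⟩
    rw [Set.insert_eq, Set.union_comm]
    refine (hp.of_le (gameDepth_mono k.le_succ)).union (hv.of_le hk) ?_
    rintro x hx _ rfl
    exact ⟨fun hn => hnear ⟨x, hx, hn⟩, hfar x hx _⟩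

theorem Rich.exists_left (hR : Rich S F G D N) {k : ℕ} (hk : gameDepth k ≤ D)
    {p : Set (F.W × G.W)} (hp : LocEq S F G (gameDepth (k + 1)) p) (hfin : p.Finite)
    (hN : p.ncard < N) (v : G.W) : ∃ u, LocEq S F G (gameDepth k) (insert (u, v) p) := by
  by_cases hnear : ∃ x ∈ p, Near S G (2 * gameDepth k + 1) x.2 v
  · obtain ⟨x, hx, hn⟩ := hnear
    exact hp.exists_left_of_near hx hn
  · obtain ⟨u, hu, hfar⟩ := hR.2 v p hfin hN
    refine ⟨u, ?_⟩
    rw [Set.insert_eq, Set.union_comm]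
    refine (hp.of_le (gameDepth_mono k.le_succ)).union (hu.of_le hk) ?_
    rintro x hx _ rfl
    exact ⟨hfar x hx _, fun hn => hnear ⟨x, hx, hn⟩⟩

/-- In rich pairs of frames, locally equivalent tuples satisfy the same formulas. -/
theorem Rich.FOSat_iff (hR : Rich S F G D N) (φ : FO I) :
    ∀ (p : Set (F.W × G.W)) (g : ℕ → F.W) (h : ℕ → G.W), relSymbols φ ⊆ S →
      gameDepth (quantRank φ) ≤ D → p.Finite → p.ncard + quantRank φ ≤ N →
      LocEq S F G (gameDepth (quantRank φ)) p → (∀ v ∈ freeVars φ, (g v, h v) ∈ p) →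
      (FOSat F g φ ↔ FOSat G h φ) := by
  classical
  have atoms : ∀ {k : ℕ} {p : Set (F.W × G.W)}, LocEq S F G k p → LocEq S F G 0 p :=
    fun h => h.of_le (Nat.zero_le _)
  have binary : ∀ {φ ψ : FO I},
      (∀ (p : Set (F.W × G.W)) (g : ℕ → F.W) (h : ℕ → G.W), relSymbols φ ⊆ S →
        gameDepth (quantRank φ) ≤ D → p.Finite → p.ncard + quantRank φ ≤ N →
        LocEq S F G (gameDepth (quantRank φ)) p → (∀ v ∈ freeVars φ, (g v, h v) ∈ p) →
        (FOSat F g φ ↔ FOSat G h φ)) →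
      (∀ (p : Set (F.W × G.W)) (g : ℕ → F.W) (h : ℕ → G.W), relSymbols ψ ⊆ S →
        gameDepth (quantRank ψ) ≤ D → p.Finite → p.ncard + quantRank ψ ≤ N →
        LocEq S F G (gameDepth (quantRank ψ)) p → (∀ v ∈ freeVars ψ, (g v, h v) ∈ p) →
        (FOSat F g ψ ↔ FOSat G h ψ)) →
      ∀ (p : Set (F.W × G.W)) (g : ℕ → F.W) (h : ℕ → G.W),
        relSymbols φ ∪ relSymbols ψ ⊆ S →
        gameDepth (max (quantRank φ) (quantRank ψ)) ≤ D → p.Finite →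
        p.ncard + max (quantRank φ) (quantRank ψ) ≤ N →
        LocEq S F G (gameDepth (max (quantRank φ) (quantRank ψ))) p →
        (∀ v ∈ freeVars φ ∪ freeVars ψ, (g v, h v) ∈ p) →
        (FOSat F g φ ↔ FOSat G h φ) ∧ (FOSat F g ψ ↔ FOSat G h ψ) := by
    intro φ ψ ih₁ ih₂ p g h hS hD hfin hN hp hfv
    have l₁ := gameDepth_mono (le_max_left (quantRank φ) (quantRank ψ))
    have l₂ := gameDepth_mono (le_max_right (quantRank φ) (quantRank ψ))
    exact ⟨ih₁ p g h (Finset.union_subset_left hS) (l₁.trans hD) hfin (by omega)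
        (hp.of_le l₁) fun v hv => hfv v (Finset.mem_union_left _ hv),
      ih₂ p g h (Finset.union_subset_right hS) (l₂.trans hD) hfin (by omega)
        (hp.of_le l₂) fun v hv => hfv v (Finset.mem_union_right _ hv)⟩
  have extend : ∀ {φ : FO I} {x : ℕ} {p : Set (F.W × G.W)} {g : ℕ → F.W} {h : ℕ → G.W}
      (u : F.W) (w : G.W), (∀ v ∈ freeVars φ \ {x}, (g v, h v) ∈ p) →
      ∀ v ∈ freeVars φ, (update g x u v, update h x w v) ∈ insert (u, w) p := by
    intro φ x p g h u w H v hv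
    by_cases hvx : v = x
    · subst hvx; simp
    · simpa [hvx] using Or.inr (H v (by simp [hv, hvx]))
  have card_insert : ∀ {p : Set (F.W × G.W)} {k : ℕ} (x : F.W × G.W),
      p.ncard + (k + 1) ≤ N → (insert x p).ncard + k ≤ N := by
    intro p k x hN
    have := Set.ncard_insert_le x p
    omega
  induction φ with
  | eq x y =>
    intro p g h _ _ _ _ hp hfv
    exact (atoms hp _ (hfv x (by simp [freeVars])) _ (hfv y (by simp [freeVars]))).1
  | rel r x y =>
    intro p g h hS _ _ _ hp hfv
    exact (atoms hp _ (hfv x (by simp [freeVars])) _ (hfv y (by simp [freeVars]))).2 r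
      (hS (Finset.mem_singleton_self r))
  | fal => intros; rfl
  | neg φ ih =>
    intro p g h hS hD hfin hN hp hfv
    exact not_congr (ih p g h hS hD hfin hN hp hfv)
  | and φ ψ ih₁ ih₂ =>
    intro p g h hS hD hfin hN hp hfv
    have := binary ih₁ ih₂ p g h hS hD hfin hN hp hfv
    exact and_congr this.1 this.2
  | or φ ψ ih₁ ih₂ =>
    intro p g h hS hD hfin hN hp hfv
    have := binary ih₁ ih₂ p g h hS hD hfin hN hp hfv
    exact or_congr this.1 this.2
  | imp φ ψ ih₁ ih₂ =>
    intro p g h hS hD hfin hN hp hfv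
    have := binary ih₁ ih₂ p g h hS hD hfin hN hp hfv
    exact imp_congr this.1 this.2
  | ex x φ ih =>
    intro p g h hS hD hfin hN hp hfv
    have hD' : gameDepth (quantRank φ) ≤ D := (gameDepth_mono (Nat.le_succ _)).trans hD
    have hN' : p.ncard < N := by simp only [quantRank] at hN; omega
    constructor
    · rintro ⟨u, hu⟩
      obtain ⟨v, hv⟩ := hR.exists_right hD' hp hfin hN' u
      exact ⟨v, (ih _ _ _ hS hD' (hfin.insert _) (card_insert _ hN) hv
        (extend u v hfv)).1 hu⟩
    · rintro ⟨v, hv⟩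
      obtain ⟨u, hu⟩ := hR.exists_left hD' hp hfin hN' v
      exact ⟨u, (ih _ _ _ hS hD' (hfin.insert _) (card_insert _ hN) hu
        (extend u v hfv)).2 hv⟩
  | all x φ ih =>
    intro p g h hS hD hfin hN hp hfv
    have hD' : gameDepth (quantRank φ) ≤ D := (gameDepth_mono (Nat.le_succ _)).trans hD
    have hN' : p.ncard < N := by simp only [quantRank] at hN; omega
    constructor
    · intro H v
      obtain ⟨u, hu⟩ := hR.exists_left hD' hp hfin hN' v
      exact (ih _ _ _ hS hD' (hfin.insert _) (card_insert _ hN) hu (extend u v hfv)).1 (H u)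
    · intro H u
      obtain ⟨v, hv⟩ := hR.exists_right hD' hp hfin hN' u
      exact (ih _ _ _ hS hD' (hfin.insert _) (card_insert _ hN) hv (extend u v hfv)).2 (H v)

end Game

/-- Fewer than `N` elements miss some copy in an `N`-fold disjoint union. -/
theorem exists_fresh_copy {I κ α : Type} {N : ℕ} (S : Finset I) (A : Fin N × κ → KFrame I)
    {p : Set α} (hfin : p.Finite) (hp : p.ncard < N) (f : α → (disjUnion A).W) :
    ∃ c : Fin N, ∀ (w : (disjUnion A).W), w.1.1 = c →
      ∀ x ∈ p, ∀ k, ¬ Near S (disjUnion A) k (f x) w := by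
  have himg : ((fun x => (f x).1.1) '' p).ncard < N :=
    (Set.ncard_image_le hfin).trans_lt hp
  obtain ⟨c, hc⟩ : ∃ c : Fin N, c ∉ (fun x => (f x).1.1) '' p := by
    by_contra! h
    rw [Set.eq_univ_of_forall h, Set.ncard_univ, Nat.card_fin] at himg
    exact himg.false
  refine ⟨c, fun w hw x hx k hn => hc ⟨x, hx, ?_⟩⟩
  rw [← hw, ← hn.fst_eq]

theorem finite_disjUnion {I ι : Type} [Finite ι] (F : ι → KFrame I) (h : ∀ i, Finite (F i).W) :
    Finite (disjUnion F).W :=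
  inferInstanceAs (Finite (Σ i, (F i).W))

/-- The preservation argument: a sentence invariant under finite disjoint unions holds in
every finite frame all of whose local types are realized in finite models of it. -/
theorem exists_restricted_of_invariant {I : Type} (θ : FO I) (hsent : freeVars θ = ∅)
    (hinv : ∀ (ι : Type) (F : ι → KFrame I), Finite ι → (∀ i, Finite (F i).W) →
        ((∀ i, FrameSat (F i) θ) ↔ FrameSat (disjUnion F) θ)) :
    ∃ (x : ℕ) (φ : FO I), TwoWayRestricted φ ∧ freeVars (FO.all x φ) = ∅ ∧
        ∀ F : KFrame I, Finite F.W → (FrameSat F θ ↔ FrameSat F (.all x φ)) := by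
  set S := relSymbols θ
  set D := gameDepth (quantRank θ)
  obtain ⟨J, _, P, hP, hloc⟩ := exists_definable_locEq S D 1
  let T : Set (Set J) :=
    {X | ∃ A : KFrame I, Finite A.W ∧ FrameSat A θ ∧ ∃ g, {j | P j A g} = X}
  obtain ⟨φ, hφ, hvars, hsat⟩ := RestrictedDefinable.setOf_mem hP T
  refine ⟨0, φ, hφ, by simpa [freeVars] using hvars, fun B hB => ?_⟩
  rw [frameSat_all]
  refine ⟨fun H g => (hsat B g).2 ⟨B, hB, H, g, rfl⟩, fun H => ?_⟩
  have hBT : ∀ g, {j | P j B g} ∈ T := fun g => (hsat B g).1 (H g)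
  rcases isEmpty_or_nonempty B.W with hE | ⟨⟨w₀⟩⟩
  · exact fun g => hE.elim (g 0)
  choose A hAfin hAθ gA hgA using fun X : T => X.2
  let N := quantRank θ + 1
  let 𝓕 : Fin N × T → KFrame I := fun i => A i.2
  let 𝓖 : Fin N × Option T → KFrame I := fun i => i.2.elim B A
  have h𝓖fin : ∀ i, Finite (𝓖 i).W := by
    rintro ⟨c, _ | X⟩
    · exact hB
    · exact hAfin X
  have h𝓕 : FrameSat (disjUnion 𝓕) θ :=
    (hinv _ 𝓕 inferInstance fun i => hAfin i.2).1 fun i => hAθ i.2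
  have hpair : ∀ {i j} (g : ℕ → (𝓕 i).W) (h : ℕ → (𝓖 j).W),
      (∀ k, P k (𝓕 i) g ↔ P k (𝓖 j) h) →
      LocEq S (disjUnion 𝓕) (disjUnion 𝓖) D {(componentIncl 𝓕 i (g 0), componentIncl 𝓖 j (h 0))} := by
    intro i j g h hgh
    refine (hloc (disjUnion 𝓕) (disjUnion 𝓖) (fun v => componentIncl 𝓕 i (g v))
      (fun v => componentIncl 𝓖 j (h v)) fun k => ?_).subset ?_
    · rw [(hP k).disjUnion_iff 𝓕 g, (hP k).disjUnion_iff 𝓖 h, hgh k]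
    · rintro _ rfl
      exact ⟨0, by simp, rfl⟩
  have hrich : Rich S (disjUnion 𝓕) (disjUnion 𝓖) D N := by
    constructor
    · rintro ⟨⟨c, X⟩, u⟩ p hfin hp
      obtain ⟨c', hc'⟩ := exists_fresh_copy S 𝓖 hfin hp Prod.snd
      exact ⟨componentIncl 𝓖 (c', some X) u,
        hpair (i := (c, X)) (j := (c', some X)) (fun _ => u) (fun _ => u) fun _ => Iff.rfl,
        hc' _ rfl⟩
    · rintro ⟨⟨c, _ | X⟩, v⟩ p hfin hp
      · obtain ⟨c', hc'⟩ := exists_fresh_copy S 𝓕 hfin hp Prod.fst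
        let X : T := ⟨_, hBT fun _ => v⟩
        exact ⟨componentIncl 𝓕 (c', X) (gA X 0),
          hpair (i := (c', X)) (j := (c, none)) (gA X) (fun _ => v)
            fun k => Set.ext_iff.1 (hgA X) k,
          hc' _ rfl⟩
      · obtain ⟨c', hc'⟩ := exists_fresh_copy S 𝓕 hfin hp Prod.fst
        exact ⟨componentIncl 𝓕 (c', X) v,
          hpair (i := (c', X)) (j := (c, some X)) (fun _ => v) (fun _ => v) fun _ => Iff.rfl,
          hc' _ rfl⟩
  have h𝓖 : FrameSat (disjUnion 𝓖) θ := by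
    intro h
    let X : T := ⟨_, hBT fun _ => w₀⟩
    refine (hrich.FOSat_iff θ ∅ (fun _ => componentIncl 𝓕 (0, X) (gA X 0)) h subset_rfl le_rfl
      Set.finite_empty (by simp [N]) (locEq_empty _) ?_).1 (h𝓕 _)
    simp [hsent]
  exact (hinv _ 𝓖 inferInstance h𝓖fin).2 h𝓖 (0, none)

/-- A first-order sentence over a signature of binary relation symbols is
invariant under disjoint unions over finite structures iff it is equivalent,
over finite structures, to a sentence of the form `∀x φ(x)` with `φ(x)` a
two-way restricted formula. -/
theorem invariance_disjoint_unions_finite {I : Type} (θ : FO I)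
    (hsent : freeVars θ = ∅) :
    (∀ (ι : Type) (F : ι → KFrame I), Finite ι → (∀ i, Finite (F i).W) →
        ((∀ i, FrameSat (F i) θ) ↔ FrameSat (disjUnion F) θ)) ↔
    (∃ (x : ℕ) (φ : FO I), TwoWayRestricted φ ∧ freeVars (FO.all x φ) = ∅ ∧
        ∀ F : KFrame I, Finite F.W → (FrameSat F θ ↔ FrameSat F (.all x φ))) := by
  refine ⟨exists_restricted_of_invariant θ hsent, ?_⟩
  rintro ⟨x, φ, hφ, hx, H⟩ ι F hι hF
  rw [H _ (finite_disjUnion F hF), ← frameSat_disjUnion_iff F hφ hx]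
  exact forall_congr' fun i => H _ (hF i)
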